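/- Let n be a natural number and C a nonempty closed subset of Euclidean space ℝⁿ. Then the inclusion Σ*(d_C) ⊆ ℝⁿ \ (C ∪ 𝒜*(C)) is a homotopy equivalence. -/

import Mathlib

open Metric Set

/-- The inclusion of a subset `A` of a topological space `Y` is a homotopy equivalence:
there is a continuous `g : Y → A` with `g ∘ incl ≃ id_A` and `incl ∘ g ≃ id_Y`. -/
def InclusionIsHomotopyEquiv {Y : Type*} [TopologicalSpace Y] (A : Set Y) : Prop :=
  ∃ g : C(Y, A),
    (g.comp ⟨(Subtype.val : A → Y), continuous_subtype_val⟩).Homotopic (ContinuousMap.id A) ∧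
    ((⟨(Subtype.val : A → Y), continuous_subtype_val⟩ : C(A, Y)).comp g).Homotopic
      (ContinuousMap.id Y)

/-- The Aubry set of a closed set `C ⊆ ℝⁿ`: points outside `C` lying on a unit-speed
minimizing geodesic ray calibrated by the distance function to `C`. -/
def AubrySet (n : ℕ) (C : Set (EuclideanSpace ℝ (Fin n))) : Set (EuclideanSpace ℝ (Fin n)) :=
  {x | x ∉ C ∧ ∃ (γ : ℝ → EuclideanSpace ℝ (Fin n)) (t₀ : ℝ), 0 < t₀ ∧
    (∀ s t : ℝ, 0 ≤ s → 0 ≤ t → ‖γ s - γ t‖ = |s - t|) ∧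
    (∀ t : ℝ, 0 ≤ t → Metric.infDist (γ t) C = t) ∧ γ t₀ = x}


section Aux

variable {n : ℕ} {C : Set (EuclideanSpace ℝ (Fin n))}

local notation "𝔼" => EuclideanSpace ℝ (Fin n)

/-- the penalized functional -/
noncomputable def GG (C : Set (EuclideanSpace ℝ (Fin n))) (x : EuclideanSpace ℝ (Fin n)) (h : ℝ)
    (y : EuclideanSpace ℝ (Fin n)) : ℝ :=
  h * infDist y C ^ 2 - ‖y - x‖ ^ 2

lemma exists_proj (hne : C.Nonempty) (hC : IsClosed C) (x : 𝔼) :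
    ∃ q ∈ C, infDist x C = ‖x - q‖ := by
  obtain ⟨q, hq, h⟩ := hC.exists_infDist_eq_dist hne x
  exact ⟨q, hq, by rw [h, dist_eq_norm]⟩

lemma infDist_le_norm {x q : 𝔼} (hq : q ∈ C) : infDist x C ≤ ‖x - q‖ := by
  rw [← dist_eq_norm]; exact infDist_le_dist_of_mem hq

lemma infDist_le_add (x y : 𝔼) : infDist x C ≤ infDist y C + ‖x - y‖ := by
  rw [← dist_eq_norm]; exact infDist_le_infDist_add_dist

lemma exists_max (C : Set (EuclideanSpace ℝ (Fin n))) (x : 𝔼) (h : ℝ) (h0 : 0 ≤ h) (h1 : h < 1) :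
    ∃ y, ∀ z, GG C x h z ≤ GG C x h y := by
  have hcont : Continuous (GG C x h) := by
    unfold GG
    have := continuous_infDist_pt C
    fun_prop
  set d := infDist x C with hd
  have hd0 : 0 ≤ d := infDist_nonneg
  obtain ⟨y, hy, hmax⟩ := (isCompact_closedBall x (2 * d / (1 - h))).exists_isMaxOn
    ⟨x, mem_closedBall_self (by have : 0 < 1 - h := by linarith
                                positivity)⟩ hcont.continuousOn
  refine ⟨y, fun z => ?_⟩
  by_cases hz : z ∈ closedBall x (2 * d / (1 - h))
  · exact hmax hz
  · refine le_trans ?_ (hmax (mem_closedBall_self (by have : 0 < 1 - h := by linarith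
                                                      positivity)))
    rw [mem_closedBall, dist_eq_norm, not_le, div_lt_iff₀ (by linarith)] at hz
    have h2 := infDist_le_add (C := C) z x
    have h3 : 0 ≤ infDist z C := infDist_nonneg
    have h4 : infDist z C ^ 2 ≤ (d + ‖z - x‖) ^ 2 := by gcongr
    have h5 := mul_le_mul_of_nonneg_left h4 h0
    have h6 := norm_nonneg (z - x)
    simp only [GG, sub_self, norm_zero]
    rw [← hd]
    have h7 := mul_le_mul_of_nonneg_left hz.le h6
    have h8 : 0 ≤ (1 - h) * (d * ‖z - x‖) := by
      have : 0 < 1 - h := by linarith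
      positivity
    nlinarith

/-- the resolvent -/
noncomputable def RR (C : Set (EuclideanSpace ℝ (Fin n))) (p : EuclideanSpace ℝ (Fin n) × ℝ) :
    EuclideanSpace ℝ (Fin n) :=
  open Classical in
  if hh : 0 ≤ p.2 ∧ p.2 < 1 then (exists_max C p.1 p.2 hh.1 hh.2).choose else p.1

lemma RR_max (x : 𝔼) {h : ℝ} (h0 : 0 ≤ h) (h1 : h < 1) (z : 𝔼) :
    GG C x h z ≤ GG C x h (RR C (x, h)) := by
  have := (exists_max C x h h0 h1).choose_spec z
  simpa [RR, h0, h1] using this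

lemma RR_zero (x : 𝔼) : RR C (x, 0) = x := by
  have := RR_max (C := C) x le_rfl one_pos x
  simp only [GG, zero_mul, sub_self, norm_zero] at this
  have h2 : ‖RR C (x, 0) - x‖ = 0 := by
    have := sq_nonneg ‖RR C (x, 0) - x‖
    exact pow_eq_zero_iff (two_ne_zero) |>.1 (by linarith)
  exact sub_eq_zero.1 (norm_eq_zero.1 h2)

lemma mid_identity (a b c : 𝔼) : ‖(1 / 2 : ℝ) • (a + b) - c‖ ^ 2 =
    1 / 2 * ‖a - c‖ ^ 2 + 1 / 2 * ‖b - c‖ ^ 2 - 1 / 4 * ‖a - b‖ ^ 2 := by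
  have e1 : (1 / 2 : ℝ) • (a + b) - c = (1 / 2 : ℝ) • ((a - c) + (b - c)) := by
    module
  have e2 : a - b = (a - c) - (b - c) := by abel
  rw [e1, e2, norm_smul, mul_pow, norm_add_sq_real, norm_sub_sq_real (a - c) (b - c)]
  norm_num
  ring

lemma GG_mid (hne : C.Nonempty) (hC : IsClosed C) (x : 𝔼) {h : ℝ} (h0 : 0 ≤ h) (a b : 𝔼) :
    1 / 2 * GG C x h a + 1 / 2 * GG C x h b + (1 - h) / 4 * ‖a - b‖ ^ 2
      ≤ GG C x h ((1 / 2 : ℝ) • (a + b)) := by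
  obtain ⟨c, hc, hd⟩ := exists_proj hne hC ((1 / 2 : ℝ) • (a + b))
  have ha := pow_le_pow_left₀ infDist_nonneg (infDist_le_norm (x := a) hc) 2
  have hb := pow_le_pow_left₀ infDist_nonneg (infDist_le_norm (x := b) hc) 2
  unfold GG
  rw [hd, mid_identity, mid_identity]
  nlinarith [mul_le_mul_of_nonneg_left ha h0, mul_le_mul_of_nonneg_left hb h0]

lemma RR_strong (hne : C.Nonempty) (hC : IsClosed C) (x : 𝔼) {h : ℝ} (h0 : 0 ≤ h) (h1 : h < 1)
    (y : 𝔼) : GG C x h y + (1 - h) / 2 * ‖RR C (x, h) - y‖ ^ 2 ≤ GG C x h (RR C (x, h)) := by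
  have e1 := GG_mid hne hC x h0 (RR C (x, h)) y
  have e2 := RR_max (C := C) x h0 h1 ((1 / 2 : ℝ) • (RR C (x, h) + y))
  linarith

lemma RR_est (hne : C.Nonempty) (hC : IsClosed C) (x x' : 𝔼) {h h' : ℝ} (h0 : 0 ≤ h) (h1 : h < 1)
    (h0' : 0 ≤ h') (h1' : h' < 1) :
    ((1 - h) / 2 + (1 - h') / 2 - |h - h'|) * ‖RR C (x, h) - RR C (x', h')‖ ≤
      2 * |h - h'| * infDist (RR C (x, h)) C + 2 * ‖x - x'‖ := by
  set R := RR C (x, h) with hR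
  set R' := RR C (x', h') with hR'
  have e1 := RR_strong hne hC x h0 h1 R'
  have e2 := RR_strong hne hC x' h0' h1' R
  rw [← hR] at e1
  rw [← hR', norm_sub_rev R' R] at e2
  have e3 : -‖R' - x‖ ^ 2 + ‖R - x‖ ^ 2 - ‖R - x'‖ ^ 2 + ‖R' - x'‖ ^ 2
      = - (2 * inner ℝ (x - x') (R - R')) := by
    simp only [norm_sub_sq_real, inner_sub_left, inner_sub_right]
    rw [real_inner_comm x R, real_inner_comm x R', real_inner_comm x' R, real_inner_comm x' R']
    ring
  have e4 : inner ℝ (x - x') (R - R') ≤ ‖x - x'‖ * ‖R - R'‖ := real_inner_le_norm _ _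
  have d1 := infDist_le_add (C := C) R R'
  have d2 := infDist_le_add (C := C) R' R
  rw [norm_sub_rev R' R] at d2
  have d3 : 0 ≤ infDist R C := infDist_nonneg
  have d4 : 0 ≤ infDist R' C := infDist_nonneg
  have e5 : (h - h') * (infDist R C ^ 2 - infDist R' C ^ 2) ≤
      |h - h'| * (‖R - R'‖ * (2 * infDist R C + ‖R - R'‖)) := by
    refine (le_abs_self _).trans ?_
    rw [abs_mul, sq_sub_sq, abs_mul, mul_comm |infDist R C + infDist R' C|]
    gcongr
    · exact abs_le.2 ⟨by linarith, by linarith⟩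
    · exact abs_le.2 ⟨by linarith, by linarith⟩
  unfold GG at e1 e2
  rcases (norm_nonneg (R - R')).eq_or_lt with h6 | h6
  · rw [← h6]
    have := abs_nonneg (h - h')
    have := norm_nonneg (x - x')
    simp only [mul_zero]
    positivity
  · refine le_of_mul_le_mul_right ?_ h6
    nlinarith

lemma RR_cont (hne : C.Nonempty) (hC : IsClosed C) :
    ContinuousOn (RR C) {p : 𝔼 × ℝ | 0 ≤ p.2 ∧ p.2 < 1} := by
  rintro ⟨x, h⟩ ⟨h0, h1⟩
  simp only at h0 h1
  rw [ContinuousWithinAt, tendsto_iff_norm_sub_tendsto_zero]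
  have hc : Filter.Tendsto (fun p : 𝔼 × ℝ => (2 * |h - p.2| * infDist (RR C (x, h)) C
      + 2 * ‖x - p.1‖) / ((1 - h) / 2 + (1 - p.2) / 2 - |h - p.2|))
      (nhdsWithin (x, h) {p : 𝔼 × ℝ | 0 ≤ p.2 ∧ p.2 < 1}) (nhds 0) := by
    have : ContinuousAt (fun p : 𝔼 × ℝ => (2 * |h - p.2| * infDist (RR C (x, h)) C
      + 2 * ‖x - p.1‖) / ((1 - h) / 2 + (1 - p.2) / 2 - |h - p.2|)) (x, h) := by
      apply ContinuousAt.div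
      · fun_prop
      · fun_prop
      · simp; linarith
    have h2 := this.tendsto
    simp only [sub_self, abs_zero, mul_zero, zero_mul, norm_zero, add_zero, zero_div] at h2
    exact h2.mono_left nhdsWithin_le_nhds
  refine squeeze_zero' (Filter.Eventually.of_forall fun _ => norm_nonneg _) ?_ hc
  have hpos : ∀ᶠ p : 𝔼 × ℝ in nhds (x, h), 0 < (1 - h) / 2 + (1 - p.2) / 2 - |h - p.2| := by
    have : ContinuousAt (fun p : 𝔼 × ℝ => (1 - h) / 2 + (1 - p.2) / 2 - |h - p.2|) (x, h) := by
      fun_prop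
    apply this.eventually (lt_mem_nhds _)
    simp; linarith
  filter_upwards [self_mem_nhdsWithin, nhdsWithin_le_nhds hpos] with p hp hp2
  rw [le_div_iff₀ hp2, norm_sub_rev, mul_comm]
  exact RR_est hne hC x p.1 h0 h1 hp.1 hp.2

/-- gradient of the squared distance at a differentiability point -/
lemma grad_sq {y q : 𝔼} (hq : q ∈ C) (hd : infDist y C = ‖y - q‖)
    (hdiff : DifferentiableAt ℝ (fun z => infDist z C) y) :
    HasFDerivAt (fun z => infDist z C ^ 2) ((2 : ℝ) • innerSL ℝ (y - q)) y := by
  have h1 : DifferentiableAt ℝ (fun z => infDist z C ^ 2) y := hdiff.pow 2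
  have h2 : HasFDerivAt (fun z : 𝔼 => ‖z - q‖ ^ 2) ((2 : ℝ) • innerSL ℝ (y - q)) y := by
    have := ((hasFDerivAt_id (𝕜 := ℝ) y).sub_const q).norm_sq
    have e : (2 • (innerSL ℝ) (id y - q) ∘SL ContinuousLinearMap.id ℝ 𝔼)
        = (2 : ℝ) • innerSL ℝ (y - q) := by
      ext v; simp
    rw [e] at this
    exact this
  have h3 := h2.sub h1.hasFDerivAt
  have hmin : IsLocalMin ((fun z : 𝔼 => ‖z - q‖ ^ 2) - (fun z => infDist z C ^ 2)) y := by
    refine Filter.Eventually.of_forall fun z => ?_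
    have := pow_le_pow_left₀ infDist_nonneg (infDist_le_norm (x := z) hq) 2
    simp only [Pi.sub_apply]
    rw [hd]; linarith
  have h4 := hmin.hasFDerivAt_eq_zero h3
  rw [sub_eq_zero] at h4
  rw [h4]; exact h1.hasFDerivAt

/-- interior points of minimizing segments are differentiability points -/
lemma diff_of_between {x y q : 𝔼} (hq : q ∈ C) (hxq : x ≠ q) (hxy : x ≠ y)
    (hx : infDist x C = ‖x - q‖) (hy : infDist y C = ‖x - q‖ + ‖y - x‖) :
    DifferentiableAt ℝ (fun z => infDist z C) x := by
  have hu : DifferentiableAt ℝ (fun z : 𝔼 => ‖z - q‖) x :=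
    (differentiableAt_id.sub_const q).norm ℝ (sub_ne_zero.2 hxq)
  have hl : DifferentiableAt ℝ (fun z : 𝔼 => infDist y C - ‖z - y‖) x :=
    ((differentiableAt_id.sub_const y).norm ℝ (sub_ne_zero.2 hxy)).const_sub _
  have hule : ∀ z : 𝔼, infDist z C ≤ ‖z - q‖ := fun z => infDist_le_norm hq
  have hlle : ∀ z : 𝔼, infDist y C - ‖z - y‖ ≤ infDist z C := fun z => by
    have := infDist_le_add (C := C) y z
    rw [norm_sub_rev] at this; linarith
  have hux := hu.hasFDerivAt
  have hlx := hl.hasFDerivAt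
  have hmin : IsLocalMin ((fun z : 𝔼 => ‖z - q‖) - (fun z => infDist y C - ‖z - y‖)) x := by
    refine Filter.Eventually.of_forall fun z => ?_
    simp only [Pi.sub_apply]
    have := hule z
    have := hlle z
    rw [norm_sub_rev y x] at hy
    linarith
  have h4 := hmin.hasFDerivAt_eq_zero (hux.sub hlx)
  rw [sub_eq_zero] at h4
  rw [← h4] at hlx
  set f' := fderiv ℝ (fun z : 𝔼 => ‖z - q‖) x
  refine HasFDerivAt.differentiableAt (f' := f') ?_
  rw [hasFDerivAt_iff_isLittleO] at hux hlx ⊢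
  rw [Asymptotics.isLittleO_iff] at hux hlx ⊢
  intro c hc
  filter_upwards [hux hc, hlx hc] with z h1 h2
  rw [Real.norm_eq_abs, abs_le] at h1 h2 ⊢
  have := hule z
  have := hlle z
  rw [norm_sub_rev y x] at hy
  constructor <;> linarith [h1.1, h1.2, h2.1, h2.2]

lemma infDist_RR_pos {x : 𝔼} {h : ℝ} (h0 : 0 < h) (h1 : h < 1) (hx : 0 < infDist x C) :
    0 < infDist (RR C (x, h)) C := by
  have := RR_max (C := C) x h0.le h1 x
  simp only [GG, sub_self, norm_zero] at this
  rcases (infDist_nonneg (x := RR C (x, h)) (s := C)).eq_or_lt with h2 | h2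
  · rw [← h2] at this
    have : 0 < h * infDist x C ^ 2 := by positivity
    nlinarith [sq_nonneg ‖RR C (x, h) - x‖]
  · exact h2

lemma RR_eq {x q : 𝔼} {h : ℝ} (h0 : 0 ≤ h) (h1 : h < 1)
    (hq : q ∈ C) (hd : infDist (RR C (x, h)) C = ‖RR C (x, h) - q‖)
    (hdiff : DifferentiableAt ℝ (fun z => infDist z C) (RR C (x, h))) :
    x = (1 - h) • RR C (x, h) + h • q := by
  have hmaxi := RR_max (C := C) x h0 h1
  set y := RR C (x, h) with hy
  have g1 := (grad_sq hq hd hdiff).const_mul h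
  have g2 := ((hasFDerivAt_id (𝕜 := ℝ) y).sub_const x).norm_sq
  have hmax : IsLocalMax (GG C x h) y := Filter.Eventually.of_forall hmaxi
  have h4 := hmax.hasFDerivAt_eq_zero (g1.sub g2)
  have h5 : inner ℝ (h • (y - q) - (y - x)) (h • (y - q) - (y - x)) = 0 := by
    have := congrArg (fun L => L (h • (y - q) - (y - x))) h4
    simp only [id, _root_.sub_apply, _root_.smul_apply,
      innerSL_apply_apply, _root_.zero_apply, ContinuousLinearMap.comp_apply,
      smul_eq_mul, ContinuousLinearMap.id_apply] at this
    conv_lhs => rw [inner_sub_left, real_inner_smul_left]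
    simp at this
    linarith
  have h6 := inner_self_eq_zero.1 h5
  have : x - ((1 - h) • y + h • q) = h • (y - q) - (y - x) := by module
  rw [h6] at this
  exact sub_eq_zero.1 this

lemma infDist_pos' (hne : C.Nonempty) (hC : IsClosed C) {x : 𝔼} (hx : x ∉ C) :
    0 < infDist x C := (hC.notMem_iff_infDist_pos hne).1 hx

lemma notMem_of_pos {x : 𝔼} (hx : 0 < infDist x C) : x ∉ C := fun h => by
  rw [infDist_zero_of_mem h] at hx; exact lt_irrefl _ hx

lemma RR_key {x q : 𝔼} {h : ℝ} (h0 : 0 < h) (h1 : h < 1) (hx : 0 < infDist x C)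
    (hq : q ∈ C) (hd : infDist (RR C (x, h)) C = ‖RR C (x, h) - q‖)
    (hdiff : DifferentiableAt ℝ (fun z => infDist z C) (RR C (x, h))) :
    infDist x C = ‖x - q‖ ∧ ‖x - q‖ = (1 - h) * ‖RR C (x, h) - q‖ ∧
      DifferentiableAt ℝ (fun z => infDist z C) x := by
  have e := RR_eq h0.le h1 hq hd hdiff
  have hpos := infDist_RR_pos h0 h1 hx
  set y := RR C (x, h) with hy
  rw [hd] at hpos
  have e1 : x - q = (1 - h) • (y - q) := by
    conv_lhs => rw [e]
    module
  have e2 : y - x = h • (y - q) := by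
    conv_lhs => rw [e]
    module
  have n1 : ‖x - q‖ = (1 - h) * ‖y - q‖ := by
    rw [e1, norm_smul, Real.norm_eq_abs, abs_of_pos (by linarith)]
  have n2 : ‖y - x‖ = h * ‖y - q‖ := by
    rw [e2, norm_smul, Real.norm_eq_abs, abs_of_pos h0]
  have d1 : infDist x C = ‖x - q‖ := by
    apply le_antisymm (infDist_le_norm hq)
    have := infDist_le_add (C := C) y x
    rw [hd, n2] at this
    rw [n1]; linarith
  refine ⟨d1, n1, diff_of_between hq ?_ ?_ d1 (y := y) ?_⟩
  · intro hxq
    rw [hxq, sub_self, norm_zero] at n1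
    have : 0 < (1 - h) * ‖y - q‖ := mul_pos (by linarith) hpos
    linarith
  · intro hxy
    rw [hxy, sub_self, norm_zero] at n2
    have : 0 < h * ‖y - q‖ := mul_pos h0 hpos
    linarith
  · rw [hd, n1, n2]; ring

lemma ray_between {x q : 𝔼} {s : ℝ} (hq : q ∈ C)
    (hd : s * ‖x - q‖ ≤ infDist (q + s • (x - q)) C) {r : ℝ} (hr0 : 0 ≤ r) (hrs : r ≤ s) :
    infDist (q + r • (x - q)) C = r * ‖x - q‖ := by
  apply le_antisymm
  · refine (infDist_le_norm hq).trans ?_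
    rw [add_sub_cancel_left, norm_smul, Real.norm_eq_abs, abs_of_nonneg hr0]
  · have := infDist_le_add (C := C) (q + s • (x - q)) (q + r • (x - q))
    have e : q + s • (x - q) - (q + r • (x - q)) = (s - r) • (x - q) := by module
    rw [e, norm_smul, Real.norm_eq_abs, abs_of_nonneg (by linarith)] at this
    linarith

lemma RR_ray (hne : C.Nonempty) (hC : IsClosed C) {x : 𝔼} {h : ℝ} (h0 : 0 < h) (h1 : h < 1)
    (hx : 0 < infDist x C)
    (hdiff : DifferentiableAt ℝ (fun z => infDist z C) (RR C (x, h))) :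
    ∃ q ∈ C, ∀ r : ℝ, 0 ≤ r → r ≤ 1 / (1 - h) →
      infDist (q + r • (x - q)) C = r * ‖x - q‖ := by
  obtain ⟨q, hq, hd⟩ := exists_proj hne hC (RR C (x, h))
  have e := RR_eq h0.le h1 hq hd hdiff
  obtain ⟨-, n1, -⟩ := RR_key h0 h1 hx hq hd hdiff
  have hh : (1 - h) ≠ 0 := by linarith
  refine ⟨q, hq, fun r hr0 hr => ray_between (s := 1 / (1 - h)) hq ?_ hr0 hr⟩
  have e1 : q + (1 / (1 - h)) • (x - q) = RR C (x, h) := by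
    have : x - q = (1 - h) • (RR C (x, h) - q) := by
      conv_lhs => rw [e]
      module
    rw [this, smul_smul, one_div_mul_cancel hh, one_smul]
    abel
  rw [e1, hd, n1, ← mul_assoc, one_div_mul_cancel hh, one_mul]

lemma local_bound (hne : C.Nonempty) (hC : IsClosed C) {x : 𝔼} (hx : x ∉ C)
    (hA : x ∉ AubrySet n C) :
    ∃ k : ℕ, ∀ᶠ x' in nhds x, x' ∉ C → ∀ h : ℝ, 1 - 1 / ((k : ℝ) + 2) ≤ h → h < 1 →
      ¬ DifferentiableAt ℝ (fun z => infDist z C) (RR C (x', h)) := by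
  by_contra hcon
  push Not at hcon
  have key : ∀ k : ℕ, ∃ x' q : 𝔼, q ∈ C ∧ dist x' x < 1 / ((k : ℝ) + 1) ∧
      ∀ r : ℝ, 0 ≤ r → r ≤ (k : ℝ) + 2 → infDist (q + r • (x' - q)) C = r * ‖x' - q‖ := by
    intro k
    have hb : ∀ᶠ x' in nhds x, dist x' x < 1 / ((k : ℝ) + 1) :=
      Metric.ball_mem_nhds x (by positivity)
    obtain ⟨x', ⟨hx', h, hk, h1, hdiff⟩, hdist⟩ := ((hcon k).and_eventually hb).exists
    have hk2 : (1 : ℝ) / ((k : ℝ) + 2) < 1 := by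
      rw [div_lt_one (by positivity)]; linarith [(Nat.cast_nonneg k : (0 : ℝ) ≤ k)]
    obtain ⟨q, hq, hr⟩ := RR_ray hne hC (by linarith) h1 (infDist_pos' hne hC hx') hdiff
    refine ⟨x', q, hq, hdist, fun r hr0 hrk => hr r hr0 (hrk.trans ?_)⟩
    rw [le_div_iff₀ (by linarith)]
    have : 1 - h ≤ 1 / ((k : ℝ) + 2) := by linarith
    rw [le_div_iff₀ (by positivity)] at this
    linarith
  choose u q hqC hu hr using key
  have hut : Filter.Tendsto u Filter.atTop (nhds x) := by
    rw [tendsto_iff_dist_tendsto_zero]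
    exact squeeze_zero (fun _ => dist_nonneg) (fun k => (hu k).le)
      tendsto_one_div_add_atTop_nhds_zero_nat
  have hbd : ∀ k, q k ∈ closedBall x (infDist x C + 2) := by
    intro k
    have h1 := hr k 1 zero_le_one (by linarith [(Nat.cast_nonneg k : (0 : ℝ) ≤ k)])
    rw [one_smul, add_sub_cancel, one_mul] at h1
    have h2 := infDist_le_add (C := C) (u k) x
    have h3 : dist (u k) x ≤ 1 := (hu k).le.trans (by
      rw [div_le_one (by positivity)]; linarith [(Nat.cast_nonneg k : (0 : ℝ) ≤ k)])
    rw [← dist_eq_norm] at h1 h2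
    rw [mem_closedBall]
    have := dist_triangle_left (q k) x (u k)
    linarith
  obtain ⟨q₀, -, φ, hφ, hqt⟩ := tendsto_subseq_of_bounded (isBounded_closedBall) hbd
  have hq₀ : q₀ ∈ C := hC.mem_of_tendsto hqt (Filter.Eventually.of_forall fun k => hqC _)
  have huφ : Filter.Tendsto (fun k => u (φ k)) Filter.atTop (nhds x) :=
    hut.comp hφ.tendsto_atTop
  have hray : ∀ r : ℝ, 0 ≤ r → infDist (q₀ + r • (x - q₀)) C = r * ‖x - q₀‖ := by
    intro r hr0
    have t1 : Filter.Tendsto (fun k => infDist (q (φ k) + r • (u (φ k) - q (φ k))) C)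
        Filter.atTop (nhds (infDist (q₀ + r • (x - q₀)) C)) :=
      ((continuous_infDist_pt C).tendsto _).comp (hqt.add ((huφ.sub hqt).const_smul r))
    have t2 : Filter.Tendsto (fun k => r * ‖u (φ k) - q (φ k)‖)
        Filter.atTop (nhds (r * ‖x - q₀‖)) := (huφ.sub hqt).norm.const_mul r
    refine tendsto_nhds_unique (t1.congr' ?_) t2
    filter_upwards [Filter.eventually_ge_atTop ⌈r⌉₊] with k hk
    refine hr (φ k) r hr0 ?_
    have h1 : r ≤ (⌈r⌉₊ : ℝ) := Nat.le_ceil r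
    have h2 : (⌈r⌉₊ : ℝ) ≤ (φ k : ℝ) := by exact_mod_cast hk.trans (hφ.id_le k)
    linarith
  have hpos : 0 < ‖x - q₀‖ := by
    rw [norm_pos_iff, sub_ne_zero]
    rintro rfl
    exact hx hq₀
  set D := ‖x - q₀‖ with hD
  refine hA ⟨hx, fun t => q₀ + (t / D) • (x - q₀), D, hpos, ?_, ?_, ?_⟩
  · intro s t _ _
    have : q₀ + (s / D) • (x - q₀) - (q₀ + (t / D) • (x - q₀)) = ((s - t) / D) • (x - q₀) := by
      module
    simp only [this]
    rw [norm_smul, ← hD, Real.norm_eq_abs, abs_div, abs_of_pos hpos,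
      div_mul_cancel₀ _ hpos.ne']
  · intro t ht
    simp only
    rw [hray _ (by positivity), div_mul_cancel₀ _ hpos.ne']
  · simp only
    rw [div_self hpos.ne', one_smul, add_sub_cancel]

lemma aubry_diff (hne : C.Nonempty) (hC : IsClosed C) {x : 𝔼} (hA : x ∈ AubrySet n C) :
    DifferentiableAt ℝ (fun z => infDist z C) x := by
  obtain ⟨hx, γ, t₀, ht, hiso, hd, rfl⟩ := hA
  have hq : γ 0 ∈ C := (hC.mem_iff_infDist_zero hne).2 (hd 0 le_rfl)
  have n1 : ‖γ t₀ - γ 0‖ = t₀ := by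
    rw [hiso _ _ ht.le le_rfl, sub_zero, abs_of_pos ht]
  have n2 : ‖γ (t₀ + 1) - γ t₀‖ = 1 := by
    rw [hiso _ _ (by linarith) ht.le]; simp
  refine diff_of_between (y := γ (t₀ + 1)) hq ?_ ?_ ?_ ?_
  · intro h; rw [h, sub_self, norm_zero] at n1; linarith
  · intro h; rw [← h, sub_self, norm_zero] at n2; linarith
  · rw [hd _ ht.le, n1]
  · rw [hd _ (by linarith), n1, n2]

lemma RR_notAubry (hne : C.Nonempty) (hC : IsClosed C) {x : 𝔼} {h : ℝ} (h0 : 0 < h) (h1 : h < 1)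
    (hx : x ∉ C) (hA : x ∉ AubrySet n C) : RR C (x, h) ∉ AubrySet n C := by
  intro hy
  have hdiff := aubry_diff hne hC hy
  obtain ⟨-, γ, t₀, ht, hiso, hd, hγ⟩ := hy
  have hq : γ 0 ∈ C := (hC.mem_iff_infDist_zero hne).2 (hd 0 le_rfl)
  have n1 : ‖RR C (x, h) - γ 0‖ = t₀ := by
    rw [← hγ, hiso _ _ ht.le le_rfl, sub_zero, abs_of_pos ht]
  have e := RR_eq h0.le h1 hq (by rw [n1, ← hγ, hd _ ht.le]) hdiff
  have hpos : 0 < (1 - h) * t₀ := mul_pos (by linarith) ht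
  have hD : dist (γ 0) (γ t₀) = t₀ := by
    rw [dist_eq_norm, hiso _ _ le_rfl ht.le, zero_sub, abs_neg, abs_of_pos ht]
  refine hA ⟨hx, γ, (1 - h) * t₀, hpos, hiso, hd, ?_⟩
  have := eq_lineMap_of_dist_eq_mul_of_dist_eq_mul (x := γ 0) (y := γ ((1 - h) * t₀))
    (z := γ t₀) (r := 1 - h) (by
      rw [hD, dist_eq_norm, hiso _ _ le_rfl hpos.le, zero_sub, abs_neg, abs_of_pos hpos])
    (by
      have : (1 - h) * t₀ - t₀ = - (h * t₀) := by ring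
      rw [hD, dist_eq_norm, hiso _ _ hpos.le ht.le, this, abs_neg, abs_of_pos (by positivity)]
      ring)
  rw [this, e, ← hγ, AffineMap.lineMap_apply_module]
  module

/-- the complement of `C ∪ A` is preserved -/
lemma RR_memY (hne : C.Nonempty) (hC : IsClosed C) {x : 𝔼} {h : ℝ} (h0 : 0 ≤ h) (h1 : h < 1)
    (hx : x ∈ (C ∪ AubrySet n C)ᶜ) : RR C (x, h) ∈ (C ∪ AubrySet n C)ᶜ := by
  rcases h0.eq_or_lt with rfl | h0
  · rwa [RR_zero]
  · rw [mem_compl_iff, mem_union, not_or] at hx ⊢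
    exact ⟨notMem_of_pos (infDist_RR_pos h0 h1 (infDist_pos' hne hC hx.1)),
      RR_notAubry hne hC h0 h1 hx.1 hx.2⟩

lemma RR_sing (hne : C.Nonempty) (hC : IsClosed C) {x : 𝔼} {h : ℝ} (h0 : 0 ≤ h) (h1 : h < 1)
    (hx : x ∉ C) (hs : ¬ DifferentiableAt ℝ (fun z => infDist z C) x) :
    ¬ DifferentiableAt ℝ (fun z => infDist z C) (RR C (x, h)) := by
  rcases h0.eq_or_lt with rfl | h0
  · rwa [RR_zero]
  · intro hd
    obtain ⟨q, hq, hdq⟩ := exists_proj hne hC (RR C (x, h))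
    exact hs (RR_key h0 h1 (infDist_pos' hne hC hx) hq hdq hd).2.2

lemma exists_time (hne : C.Nonempty) (hC : IsClosed C) :
    ∃ T : C(((C ∪ AubrySet n C)ᶜ : Set 𝔼), ℝ), ∀ x, 0 ≤ T x ∧ T x < 1 ∧
      ¬ DifferentiableAt ℝ (fun z => infDist z C) (RR C (x, T x)) := by
  suffices H : ∃ T : C(((C ∪ AubrySet n C)ᶜ : Set 𝔼), ℝ),
      ∀ x : ((C ∪ AubrySet n C)ᶜ : Set 𝔼), T x ∈
      {h : ℝ | 0 ≤ h ∧ h < 1 ∧ ∀ h', h ≤ h' → h' < 1 →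
        ¬ DifferentiableAt ℝ (fun z => infDist z C) (RR C (x, h'))} by
    obtain ⟨T, hT⟩ := H
    exact ⟨T, fun x => ⟨(hT x).1, (hT x).2.1, (hT x).2.2 _ le_rfl (hT x).2.1⟩⟩
  refine exists_continuous_forall_mem_convex_of_local_const 
    (t := fun x : ((C ∪ AubrySet n C)ᶜ : Set 𝔼) => {h : ℝ | 0 ≤ h ∧ h < 1 ∧
    ∀ h', h ≤ h' → h' < 1 →
      ¬ DifferentiableAt ℝ (fun z => infDist z C) (RR C ((x : 𝔼), h'))}) ?_ ?_
  · intro x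
    refine OrdConnected.convex ⟨?_⟩
    rintro a ⟨ha0, ha1, ha⟩ b ⟨hb0, hb1, hb⟩ c ⟨hac, hcb⟩
    exact ⟨by linarith, by linarith, fun h' h1 h2 => ha h' (by linarith) h2⟩
  · intro x₀
    have hx := x₀.2
    rw [mem_compl_iff, mem_union, not_or] at hx
    obtain ⟨k, hk⟩ := local_bound hne hC hx.1 hx.2
    refine ⟨1 - 1 / ((k : ℝ) + 2), ?_⟩
    have hk' := (continuous_subtype_val.tendsto x₀).eventually hk
    filter_upwards [hk'] with y hy
    have hyC : (y : 𝔼) ∉ C := fun h => y.2 (Or.inl h)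
    have h2 : (1 : ℝ) / ((k : ℝ) + 2) < 1 := by
      rw [div_lt_one (by positivity)]; linarith [(Nat.cast_nonneg k : (0 : ℝ) ≤ k)]
    have h3 : 0 < (1 : ℝ) / ((k : ℝ) + 2) := by positivity
    exact ⟨by linarith, by linarith, hy hyC⟩

end Aux

/-- For a nonempty closed `C ⊆ ℝⁿ`, the inclusion
`Σ*(d_C) ⊆ ℝⁿ \ (C ∪ 𝒜*(C))` is a homotopy equivalence. -/
theorem sigma_star_inclusion_homotopyEquiv (n : ℕ)
    (C : Set (EuclideanSpace ℝ (Fin n))) (hne : C.Nonempty) (hC : IsClosed C) :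
    ({x : EuclideanSpace ℝ (Fin n) |
        x ∉ C ∧ ¬ DifferentiableAt ℝ (fun y => Metric.infDist y C) x}
      ⊆ (C ∪ AubrySet n C)ᶜ) ∧
    InclusionIsHomotopyEquiv
      {y : ((C ∪ AubrySet n C)ᶜ : Set (EuclideanSpace ℝ (Fin n))) |
        (y : EuclideanSpace ℝ (Fin n)) ∉ C ∧
        ¬ DifferentiableAt ℝ (fun z => Metric.infDist z C) (y : EuclideanSpace ℝ (Fin n))} := by
  refine ⟨fun x hx h => h.elim hx.1 fun hA => hx.2 (aubry_diff hne hC hA), ?_⟩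
  obtain ⟨T, hT⟩ := exists_time hne hC
  have hts : ∀ (t : unitInterval) (x : ((C ∪ AubrySet n C)ᶜ : Set (EuclideanSpace ℝ (Fin n)))),
      0 ≤ (t : ℝ) * T x ∧ (t : ℝ) * T x < 1 := fun t x =>
    ⟨mul_nonneg t.2.1 (hT x).1,
      (mul_le_of_le_one_left (hT x).1 t.2.2).trans_lt (hT x).2.1⟩
  have hcont : Continuous (fun p : unitInterval ×
      ((C ∪ AubrySet n C)ᶜ : Set (EuclideanSpace ℝ (Fin n))) =>
      RR C ((p.2 : EuclideanSpace ℝ (Fin n)), (p.1 : ℝ) * T p.2)) :=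
    (RR_cont hne hC).comp_continuous (by fun_prop) (fun p => hts p.1 p.2)
  have hY := fun (t : unitInterval)
      (x : ((C ∪ AubrySet n C)ᶜ : Set (EuclideanSpace ℝ (Fin n)))) =>
    RR_memY hne hC (hts t x).1 (hts t x).2 x.2
  have hYC : ∀ x : ((C ∪ AubrySet n C)ᶜ : Set (EuclideanSpace ℝ (Fin n))),
    (x : EuclideanSpace ℝ (Fin n)) ∉ C := fun x h => x.2 (Or.inl h)
  have hone : ∀ x : ((C ∪ AubrySet n C)ᶜ : Set (EuclideanSpace ℝ (Fin n))),
    RR C ((x : EuclideanSpace ℝ (Fin n)), ((1 : unitInterval) : ℝ) * T x)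
      = RR C ((x : EuclideanSpace ℝ (Fin n)), T x) := fun x => by simp
  refine ⟨⟨fun x => ⟨⟨RR C ((x : EuclideanSpace ℝ (Fin n)), ((1 : unitInterval) : ℝ) * T x),
    hY 1 x⟩, hYC ⟨_, hY 1 x⟩, ?_⟩, ?_⟩, ?_, ?_⟩
  · simp only [hone]
    exact (hT x).2.2
  · exact Continuous.subtype_mk (Continuous.subtype_mk
      (hcont.comp (Continuous.prodMk continuous_const continuous_id)) _) _
  · refine ContinuousMap.Homotopic.symm ⟨⟨⟨fun p => ⟨⟨RR C (((p.2 :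
      ((C ∪ AubrySet n C)ᶜ : Set (EuclideanSpace ℝ (Fin n)))) : EuclideanSpace ℝ (Fin n)),
        (p.1 : ℝ) * T p.2), hY p.1 p.2⟩, hYC ⟨_, hY p.1 p.2⟩, ?_⟩, ?_⟩, ?_, ?_⟩⟩
    · exact RR_sing hne hC (hts p.1 p.2).1 (hts p.1 p.2).2 p.2.2.1 p.2.2.2
    · exact Continuous.subtype_mk (Continuous.subtype_mk
        (hcont.comp (Continuous.prodMk continuous_fst
          (continuous_subtype_val.comp continuous_snd))) _) _
    · intro x
      apply Subtype.ext
      apply Subtype.ext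
      simp [RR_zero]
      rfl
    · intro x
      rfl
  · refine ContinuousMap.Homotopic.symm ⟨⟨⟨fun p => ⟨RR C ((p.2 : EuclideanSpace ℝ (Fin n)),
        (p.1 : ℝ) * T p.2), hY p.1 p.2⟩, ?_⟩, ?_, ?_⟩⟩
    · exact Continuous.subtype_mk hcont _
    · intro x
      apply Subtype.ext
      simp [RR_zero]
    · intro x
      rfl
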